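/- arXiv:1009.3461 — 2 statements merged into one kernel-verified Lean document; each statement's English description precedes it below -/
import Mathlib

section
/- Let X be a complex infinite-dimensional Banach space and let T = λ·I + S be a bounded linear operator on X, where S is strictly singular and λ ∈ ℂ satisfies |λ| > 1. Then the J-set J_T(x) has empty interior for every non-zero vector x ∈ X. -/
open Filter Topology

/-- The J-set of `x` under the operator `T`. -/
def JSet {𝕜 X : Type*} [NontriviallyNormedField 𝕜] [NormedAddCommGroup X] [NormedSpace 𝕜 X]
    (T : X →L[𝕜] X) (x : X) : Set X :=
  {y | ∃ k : ℕ → ℕ, StrictMono k ∧ ∃ u : ℕ → X,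
    Tendsto u atTop (𝓝 x) ∧ Tendsto (fun n => (T ^ k n) (u n)) atTop (𝓝 y)}

/-- A bounded operator is strictly singular if it is bounded below by no positive constant
on any infinite-dimensional subspace. -/
def StrictlySingular {𝕜 X : Type*} [NontriviallyNormedField 𝕜] [NormedAddCommGroup X]
    [NormedSpace 𝕜 X] (S : X →L[𝕜] X) : Prop :=
  ∀ M : Submodule 𝕜 X, ¬ FiniteDimensional 𝕜 M →
    ¬ ∃ c : ℝ, 0 < c ∧ ∀ x ∈ M, c * ‖x‖ ≤ ‖S x‖


namespace JProof

variable {X : Type*} [NormedAddCommGroup X] [NormedSpace ℂ X]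

/-- Unit plus finite rank. -/
def Phi0 (A : X →L[ℂ] X) : Prop :=
  ∃ F : X →L[ℂ] X, FiniteDimensional ℂ (LinearMap.range (F : X →ₗ[ℂ] X)) ∧ IsUnit (A + F)

/-- Proper on bounded sets. -/
def Prp (A : X →L[ℂ] X) : Prop :=
  ∀ x : ℕ → X, (∃ R, ∀ n, ‖x n‖ ≤ R) → ∀ y, Tendsto (fun n => A (x n)) atTop (𝓝 y) →
    ∃ a, ∃ φ : ℕ → ℕ, StrictMono φ ∧ Tendsto (fun n => x (φ n)) atTop (𝓝 a)

lemma finrk_add (F G : X →L[ℂ] X) (hF : FiniteDimensional ℂ (LinearMap.range (F : X →ₗ[ℂ] X)))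
    (hG : FiniteDimensional ℂ (LinearMap.range (G : X →ₗ[ℂ] X))) :
    FiniteDimensional ℂ (LinearMap.range ((F + G : X →L[ℂ] X) : X →ₗ[ℂ] X)) := by
  have h : LinearMap.range ((F + G : X →L[ℂ] X) : X →ₗ[ℂ] X) ≤
      LinearMap.range (F : X →ₗ[ℂ] X) ⊔ LinearMap.range (G : X →ₗ[ℂ] X) := by
    rintro _ ⟨x, rfl⟩
    exact Submodule.add_mem_sup ⟨x, rfl⟩ ⟨x, rfl⟩
  exact Submodule.finiteDimensional_of_le h

lemma finrk_neg (F : X →L[ℂ] X) (hF : FiniteDimensional ℂ (LinearMap.range (F : X →ₗ[ℂ] X))) :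
    FiniteDimensional ℂ (LinearMap.range ((-F : X →L[ℂ] X) : X →ₗ[ℂ] X)) := by
  have h : LinearMap.range ((-F : X →L[ℂ] X) : X →ₗ[ℂ] X) ≤
      LinearMap.range (F : X →ₗ[ℂ] X) := by
    rintro _ ⟨x, rfl⟩
    exact ⟨-x, by simp⟩
  exact Submodule.finiteDimensional_of_le h

lemma Phi0.add {A F : X →L[ℂ] X} (hA : Phi0 A)
    (hF : FiniteDimensional ℂ (LinearMap.range (F : X →ₗ[ℂ] X))) : Phi0 (A + F) := by
  obtain ⟨G, hG, hu⟩ := hA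
  refine ⟨-F + G, finrk_add _ _ (finrk_neg _ hF) hG, ?_⟩
  convert hu using 1
  abel

lemma Phi0.of_add {A F : X →L[ℂ] X} 
    (hF : FiniteDimensional ℂ (LinearMap.range (F : X →ₗ[ℂ] X))) (hA : Phi0 (A + F)) : Phi0 A := by
  have := hA.add (finrk_neg _ hF)
  simpa using this

lemma Phi0.of_isUnit {A : X →L[ℂ] X} (h : IsUnit A) : Phi0 A := by
  refine ⟨0, ?_, by simpa using h⟩
  have : LinearMap.range ((0 : X →L[ℂ] X) : X →ₗ[ℂ] X) = ⊥ := by simp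
  rw [this]; infer_instance

lemma one_sub_alt (G : X →L[ℂ] X) (hG : FiniteDimensional ℂ (LinearMap.range (G : X →ₗ[ℂ] X))) :
    Function.Bijective (1 - G : X →L[ℂ] X) ∨ ((∃ x, x ≠ 0 ∧ (1 - G : X →L[ℂ] X) x = 0) ∧
      ∃ ψ : X →L[ℂ] ℂ, ψ ≠ 0 ∧ ∀ x, ψ ((1 - G : X →L[ℂ] X) x) = 0) := by
  set E := LinearMap.range (G : X →ₗ[ℂ] X) with hE
  have hGE : ∀ x, G x ∈ E := fun x => ⟨x, rfl⟩
  let g : E →ₗ[ℂ] E := LinearMap.id - ((G : X →ₗ[ℂ] X).codRestrict E hGE) ∘ₗ E.subtype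
  have hg : ∀ e : E, ((g e : E) : X) = (e : X) - G e := fun e => by simp [g]
  by_cases hi : Function.Injective g
  · left
    have hs : Function.Surjective g := LinearMap.injective_iff_surjective.1 hi
    constructor
    · rw [injective_iff_map_eq_zero]
      intro x hx
      have hx' : x = G x := by simpa [sub_eq_zero] using hx
      have hxE : x ∈ E := by rw [hx']; exact hGE x
      have : g ⟨x, hxE⟩ = 0 := by
        apply Subtype.ext; rw [hg]; simpa using hx
      have := (injective_iff_map_eq_zero g).1 hi _ this
      simpa using congrArg Subtype.val this
    · intro y
      obtain ⟨e, he⟩ := hs ⟨G y, hGE y⟩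
      have he' : (e : X) - G e = G y := by rw [← hg, he]
      refine ⟨y + e, ?_⟩
      have h3 : (1 - G : X →L[ℂ] X) (y + e) = y + (e : X) - G (y + e) := rfl
      rw [h3, map_add]
      calc y + (e : X) - (G y + G e) = y + ((e : X) - G e) - G y := by abel
        _ = y := by rw [he']; abel
  · right
    have hs : ¬ Function.Surjective g := fun h => hi (LinearMap.injective_iff_surjective.2 h)
    constructor
    · rw [injective_iff_map_eq_zero] at hi
      push Not at hi
      obtain ⟨e, he, hne⟩ := hi
      refine ⟨e, by simpa using hne, ?_⟩
      have := hg e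
      rw [he] at this
      simpa using this.symm
    · obtain ⟨θ, hθ, hle⟩ := Submodule.exists_le_ker_of_lt_top (LinearMap.range g)
        (lt_top_iff_ne_top.2 (fun h => hs (LinearMap.range_eq_top.1 h)))
      have hθg : ∀ e, θ (g e) = 0 := fun e => hle ⟨e, rfl⟩
      let ψ : X →L[ℂ] ℂ := (LinearMap.toContinuousLinearMap θ) ∘L (G.codRestrict E hGE)
      have hψ : ∀ x, ψ x = θ ⟨G x, hGE x⟩ := fun x => rfl
      refine ⟨ψ, ?_, ?_⟩
      · intro h0
        apply hθ
        ext e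
        have h1 := hθg e
        have h2 : g e = e - ⟨G e, hGE e⟩ := Subtype.ext (by rw [hg]; rfl)
        rw [h2, map_sub, ← hψ, h0] at h1
        simpa using h1
      · intro x
        rw [hψ, ← hθg ⟨G x, hGE x⟩]
        congr 1
        apply Subtype.ext
        rw [hg]; simp

lemma Phi0.alt [CompleteSpace X] {A : X →L[ℂ] X} (hA : Phi0 A) :
    IsUnit A ∨ ((∃ x, x ≠ 0 ∧ A x = 0) ∧ ∃ ψ : X →L[ℂ] ℂ, ψ ≠ 0 ∧ ∀ x, ψ (A x) = 0) := by
  obtain ⟨F, hF, u, hu⟩ := hA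
  let C : X →L[ℂ] X := u
  let D : X →L[ℂ] X := ↑(u⁻¹)
  have hCD : C * D = 1 := u.mul_inv
  have hDC : D * C = 1 := u.inv_mul
  have hA : A = C * (1 - D * F) := by
    rw [mul_sub, ← mul_assoc, hCD]; simp [C, hu]
  have hfin : FiniteDimensional ℂ (LinearMap.range ((D * F : X →L[ℂ] X) : X →ₗ[ℂ] X)) := by
    have : ((D * F : X →L[ℂ] X) : X →ₗ[ℂ] X) = (D : X →ₗ[ℂ] X) ∘ₗ (F : X →ₗ[ℂ] X) := rfl
    rw [this, LinearMap.range_comp]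
    infer_instance
  rcases one_sub_alt (D * F) hfin with h | ⟨⟨x, hx, hx0⟩, ψ, hψ, hψ0⟩
  · left
    rw [hA]
    exact u.isUnit.mul (ContinuousLinearMap.isUnit_iff_bijective.2 h)
  · right
    refine ⟨⟨x, hx, ?_⟩, ψ ∘L D, ?_, ?_⟩
    · rw [hA, mul_apply_eq_comp, hx0, map_zero]
    · intro h
      apply hψ
      have : ψ = (ψ ∘L D) ∘L C := by
        rw [ContinuousLinearMap.comp_assoc]
        change ψ = ψ ∘L (D * C)
        rw [hDC]; rfl
      rw [this, h]; simp
    · intro y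
      have : (ψ ∘L D) (A y) = ψ ((D * A) y) := rfl
      rw [this, hA, ← mul_assoc, hDC, one_mul, hψ0]

lemma Phi0.unit_of_inj [CompleteSpace X] {A : X →L[ℂ] X} (hA : Phi0 A) (h : ∀ x, A x = 0 → x = 0) : IsUnit A := by
  rcases hA.alt with h1 | ⟨⟨x, hx, hx0⟩, -⟩
  · exact h1
  · exact absurd (h x hx0) hx

lemma Phi0.unit_of_surj [CompleteSpace X] {A : X →L[ℂ] X} (hA : Phi0 A) (h : Function.Surjective A) :
    IsUnit A := by
  rcases hA.alt with h1 | ⟨-, ψ, hψ, hψ0⟩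
  · exact h1
  · refine absurd ?_ hψ
    ext y
    obtain ⟨x, rfl⟩ := h y
    simpa using hψ0 x

lemma Prp.add {A F : X →L[ℂ] X} (hA : Prp A)
    (hF : FiniteDimensional ℂ (LinearMap.range (F : X →ₗ[ℂ] X))) : Prp (A + F) := by
  rintro x ⟨R, hR⟩ y hy
  set E := LinearMap.range (F : X →ₗ[ℂ] X) with hE
  have hFE : ∀ x, F x ∈ E := fun x => ⟨x, rfl⟩
  have : ProperSpace E := FiniteDimensional.proper ℂ E
  obtain ⟨a, -, φ, hφ, ha⟩ := tendsto_subseq_of_bounded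
    (Metric.isBounded_closedBall (x := (0 : E)) (r := ‖F‖ * R))
    (x := fun n => (⟨F (x n), hFE _⟩ : E)) (fun n => by
      rw [mem_closedBall_zero_iff]
      exact (F.le_opNorm _).trans (by gcongr; exact hR n))
  have ha' : Tendsto (fun n => F (x (φ n))) atTop (𝓝 (a : X)) :=
    (continuous_subtype_val.tendsto a).comp ha
  have h2 : Tendsto (fun n => A (x (φ n))) atTop (𝓝 (y - a)) := by
    have := (hy.comp hφ.tendsto_atTop).sub ha'
    refine this.congr fun n => by simp
  obtain ⟨b, χ, hχ, hb⟩ := hA (fun n => x (φ n)) ⟨R, fun n => hR _⟩ _ h2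
  exact ⟨b, fun n => φ (χ n), hφ.comp hχ, hb⟩

lemma Prp.bddBelow {A : X →L[ℂ] X} (hA : Prp A) (hi : ∀ x, A x = 0 → x = 0) :
    ∃ c : ℝ, 0 < c ∧ ∀ x, c * ‖x‖ ≤ ‖A x‖ := by
  by_contra! h
  have h1 : ∀ n : ℕ, ∃ x : X, ‖x‖ = 1 ∧ ‖A x‖ ≤ 1 / ((n : ℝ) + 1) := by
    intro n
    obtain ⟨x, hx⟩ := h (1 / ((n : ℝ) + 1)) (by positivity)
    have hx0 : x ≠ 0 := by rintro rfl; simp at hx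
    have hn : 0 < ‖x‖ := norm_pos_iff.2 hx0
    refine ⟨((‖x‖⁻¹ : ℝ) : ℂ) • x, ?_, ?_⟩
    · rw [norm_smul]; simp [hn.ne']
    · rw [map_smul, norm_smul]
      simp only [Complex.norm_real, norm_inv, norm_norm]
      rw [inv_mul_le_iff₀ hn, mul_comm]
      exact hx.le
  choose x hx1 hx2 using h1
  have h3 : Tendsto (fun n => A (x n)) atTop (𝓝 0) :=
    squeeze_zero_norm hx2 tendsto_one_div_add_atTop_nhds_zero_nat
  obtain ⟨a, φ, hφ, ha⟩ := hA x ⟨1, fun n => (hx1 n).le⟩ 0 h3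
  have h4 : A a = 0 := tendsto_nhds_unique ((A.continuous.tendsto a).comp ha)
    (h3.comp hφ.tendsto_atTop)
  have h5 : ‖a‖ = 1 := tendsto_nhds_unique ha.norm (by simp [hx1])
  rw [hi a h4] at h5
  simp at h5

lemma Prp.ker_fin {A : X →L[ℂ] X} (hA : Prp A) :
    FiniteDimensional ℂ (LinearMap.ker (A : X →ₗ[ℂ] X)) := by
  apply FiniteDimensional.of_isCompact_closedBall ℂ (zero_lt_one) (c := 0)
  apply IsSeqCompact.isCompact
  intro x hx
  obtain ⟨a, φ, hφ, ha⟩ := hA (fun n => (x n : X)) ⟨1, fun n => by simpa using hx n⟩ 0 (by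
    have : ∀ n, A (x n : X) = 0 := fun n => (x n).2
    simp [this])
  have ha0 : A a = 0 := by
    refine tendsto_nhds_unique ((A.continuous.tendsto a).comp ha) ?_
    have : ∀ n, A (x n : X) = 0 := fun n => (x n).2
    simp [Function.comp_def, this]
  have ht : Tendsto (x ∘ φ) atTop (𝓝 (⟨a, ha0⟩ : LinearMap.ker (A : X →ₗ[ℂ] X))) :=
    tendsto_subtype_rng.2 ha
  exact ⟨⟨a, ha0⟩, Metric.isClosed_closedBall.mem_of_tendsto ht
    (Eventually.of_forall fun n => hx _), φ, hφ, ht⟩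

lemma exists_rinv [CompleteSpace X] {A : X →L[ℂ] X}
    (hK : FiniteDimensional ℂ (LinearMap.ker (A : X →ₗ[ℂ] X))) (hs : Function.Surjective A) :
    ∃ R : X →L[ℂ] X, A * R = 1 := by
  obtain ⟨P, hP⟩ := Submodule.ClosedComplemented.of_finiteDimensional
    (𝕜 := ℂ) (LinearMap.ker (A : X →ₗ[ℂ] X))
  let L : X →L[ℂ] X × LinearMap.ker (A : X →ₗ[ℂ] X) := A.prod P
  have hL : ∀ x, L x = (A x, P x) := fun x => rfl
  have hinj : LinearMap.ker (L : X →ₗ[ℂ] X × LinearMap.ker (A : X →ₗ[ℂ] X)) = ⊥ := by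
    rw [LinearMap.ker_eq_bot']
    intro x hx
    have hx' : (A x, P x) = 0 := hx
    rw [Prod.mk_eq_zero] at hx'
    have := hP ⟨x, hx'.1⟩
    have h2 : (P x : X) = x := congrArg Subtype.val this
    rw [← h2, hx'.2]; rfl
  have hsur : LinearMap.range (L : X →ₗ[ℂ] X × LinearMap.ker (A : X →ₗ[ℂ] X)) = ⊤ := by
    rw [LinearMap.range_eq_top]
    rintro ⟨y, k⟩
    obtain ⟨x, rfl⟩ := hs y
    refine ⟨x - P x + k, ?_⟩
    have h1 : ∀ k : LinearMap.ker (A : X →ₗ[ℂ] X), A (k : X) = 0 := fun k => k.2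
    change (A _, P _) = _
    simp [h1, hP]
  let e := ContinuousLinearEquiv.ofBijective L hinj hsur
  refine ⟨(e.symm : (X × LinearMap.ker (A : X →ₗ[ℂ] X)) →L[ℂ] X) ∘L ContinuousLinearMap.inl ℂ _ _, ?_⟩
  ext y
  have : L (e.symm (y, 0)) = (y, 0) :=
    ContinuousLinearEquiv.ofBijective_apply_symm_apply L hinj hsur _
  rw [hL] at this
  exact (Prod.mk.inj this).1

lemma phi0_closure_inj [CompleteSpace X] {A : X →L[ℂ] X} (hA : Prp A)
    (hc : A ∈ closure {B | Phi0 B}) (hi : ∀ x, A x = 0 → x = 0) : Phi0 A := by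
  obtain ⟨c, hc0, hb⟩ := hA.bddBelow hi
  obtain ⟨B, hB, hAB⟩ := Metric.mem_closure_iff.1 hc (c / 3) (by positivity)
  rw [dist_eq_norm] at hAB
  have hBb : ∀ x, (2 * c / 3) * ‖x‖ ≤ ‖B x‖ := by
    intro x
    have h1 : ‖(A - B) x‖ ≤ c / 3 * ‖x‖ := 
      ((A - B).le_opNorm x).trans (by gcongr)
    have h2 : ‖A x‖ ≤ ‖(A - B) x‖ + ‖B x‖ := by
      have : A x = (A - B) x + B x := by simp
      rw [this]; exact norm_add_le _ _
    linarith [hb x]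
  have hu : IsUnit B := Phi0.unit_of_inj hB fun x hx => by
    have := hBb x
    rw [hx, norm_zero] at this
    have h3 : ‖x‖ ≤ 0 := by
      by_contra! h
      have : 0 < 2 * c / 3 * ‖x‖ := by positivity
      linarith
    simpa using h3
  obtain ⟨u, rfl⟩ := hu
  let D : X →L[ℂ] X := ↑(u⁻¹)
  have hD : ‖D‖ ≤ 3 / (2 * c) := by
    refine D.opNorm_le_bound (by positivity) fun y => ?_
    have h1 := hBb (D y)
    have h2 : (u : X →L[ℂ] X) (D y) = y := by
      change ((u : X →L[ℂ] X) * D) y = y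
      have : (u : X →L[ℂ] X) * D = 1 := u.mul_inv
      rw [this]; rfl
    rw [h2] at h1
    rw [div_mul_eq_mul_div, le_div_iff₀ (by positivity)]
    linarith
  have hlt : ‖D * (u - A)‖ < 1 := by
    calc ‖D * (u - A)‖ ≤ ‖D‖ * ‖(u : X →L[ℂ] X) - A‖ := norm_mul_le _ _
      _ ≤ 3 / (2 * c) * (c / 3) := by
        rw [norm_sub_rev] at hAB
        gcongr
      _ < 1 := by field_simp; norm_num
  have h5 : IsUnit (1 - D * (u - A)) := isUnit_one_sub_of_norm_lt_one hlt
  have h6 : A = u * (1 - D * (u - A)) := by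
    have h1 : (u : X →L[ℂ] X) * D = 1 := u.mul_inv
    rw [mul_sub, ← mul_assoc, h1]; simp
  apply Phi0.of_isUnit
  rw [h6]
  exact u.isUnit.mul h5

lemma phi0_closure_surj [CompleteSpace X] {A : X →L[ℂ] X} (hA : Prp A)
    (hc : A ∈ closure {B | Phi0 B}) (hs : Function.Surjective A) : Phi0 A := by
  obtain ⟨R, hR⟩ := exists_rinv hA.ker_fin hs
  obtain ⟨B, hB, hAB⟩ := Metric.mem_closure_iff.1 hc (1 / (‖R‖ + 1)) (by positivity)
  rw [dist_eq_norm] at hAB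
  have hlt : ‖(A - B) * R‖ < 1 := by
    calc ‖(A - B) * R‖ ≤ ‖A - B‖ * ‖R‖ := norm_mul_le _ _
      _ ≤ 1 / (‖R‖ + 1) * ‖R‖ := by gcongr
      _ < 1 := by
        rw [one_div, inv_mul_lt_iff₀ (by positivity)]; linarith
  have h5 : IsUnit (1 - (A - B) * R) := isUnit_one_sub_of_norm_lt_one hlt
  have h6 : B * R = 1 - (A - B) * R := by rw [sub_mul, hR]; abel
  rw [← h6] at h5
  have hBs : Function.Surjective B := by
    intro y
    obtain ⟨x, hx⟩ := (ContinuousLinearMap.isUnit_iff_bijective.1 h5).2 y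
    exact ⟨R x, hx⟩
  obtain ⟨u, rfl⟩ := Phi0.unit_of_surj hB hBs
  have hRu : IsUnit R := (Units.isUnit_units_mul u R).1 h5
  obtain ⟨v, rfl⟩ := hRu
  have : A = ↑(v⁻¹) := by
    exact (Units.mul_eq_one_iff_eq_inv).1 hR
  exact Phi0.of_isUnit (this ▸ (v⁻¹).isUnit)

lemma phi0_closure [CompleteSpace X] (n : ℕ) : ∀ {A : X →L[ℂ] X}, Prp A →
    A ∈ closure {B | Phi0 B} → Module.finrank ℂ (LinearMap.ker (A : X →ₗ[ℂ] X)) = n →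
    Phi0 A := by
  induction n using Nat.strong_induction_on with
  | _ n ih =>
  intro A hA hc hn
  by_cases hi : ∀ x, A x = 0 → x = 0
  · exact phi0_closure_inj hA hc hi
  by_cases hs : Function.Surjective A
  · exact phi0_closure_surj hA hc hs
  push Not at hi
  obtain ⟨k, hk, hk0⟩ := hi
  unfold Function.Surjective at hs
  push Not at hs
  obtain ⟨v, hv⟩ := hs
  obtain ⟨f, -, hf⟩ := exists_dual_vector ℂ k (norm_ne_zero_iff.2 hk0)
  have hfk : f k ≠ 0 := by rw [hf]; simpa using hk0
  let F : X →L[ℂ] X := f.smulRight v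
  have hFx : ∀ x, F x = f x • v := fun x => rfl
  have hF : FiniteDimensional ℂ (LinearMap.range (F : X →ₗ[ℂ] X)) := by
    have : LinearMap.range (F : X →ₗ[ℂ] X) ≤ ℂ ∙ v := by
      rintro _ ⟨x, rfl⟩
      exact Submodule.mem_span_singleton.2 ⟨f x, rfl⟩
    exact Submodule.finiteDimensional_of_le this
  have hlt : LinearMap.ker ((A + F : X →L[ℂ] X) : X →ₗ[ℂ] X) < LinearMap.ker (A : X →ₗ[ℂ] X) := by
    have key : ∀ x, (A + F) x = 0 → f x = 0 ∧ A x = 0 := by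
      intro x hx
      have hx' : A x + f x • v = 0 := hx
      have hfx : f x = 0 := by
        by_contra h0
        apply hv (-((f x)⁻¹ • x))
        rw [map_neg, map_smul, eq_neg_of_add_eq_zero_left hx', smul_neg, neg_neg, smul_smul,
          inv_mul_cancel₀ h0, one_smul]
      refine ⟨hfx, ?_⟩
      simpa [hfx] using hx'
    refine lt_of_le_of_ne (fun x hx => (key x hx).2) fun h => ?_
    have : k ∈ LinearMap.ker ((A + F : X →L[ℂ] X) : X →ₗ[ℂ] X) := by rw [h]; exact hk
    exact hfk (key k this).1
  have hfin := hA.ker_fin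
  have hlt' := Submodule.finrank_lt_finrank_of_lt hlt
  rw [hn] at hlt'
  refine Phi0.of_add hF (ih _ hlt' (hA.add hF) ?_ rfl)
  have hcont : Continuous fun B : X →L[ℂ] X => B + F := by fun_prop
  exact map_mem_closure (f := fun B : X →L[ℂ] X => B + F) hcont hc fun B hB => Phi0.add hB hF

lemma phi0_open [CompleteSpace X] : IsOpen {A : X →L[ℂ] X | Phi0 A} := by
  have : {A : X →L[ℂ] X | Phi0 A} = ⋃ F ∈ {F : X →L[ℂ] X |
      FiniteDimensional ℂ (LinearMap.range (F : X →ₗ[ℂ] X))}, {A | IsUnit (A + F)} := by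
    ext A; simp [Phi0]
  rw [this]
  refine isOpen_biUnion fun F _ => ?_
  exact Units.isOpen.preimage (f := fun A : X →L[ℂ] X => A + F) (by fun_prop)

/-- Path argument. -/
lemma phi0_path [CompleteSpace X] (c : ℂ) (hc : c ≠ 0) (S : X →L[ℂ] X)
    (h : ∀ t : ℝ, Prp (c • (1 : X →L[ℂ] X) + (t : ℂ) • S)) :
    Phi0 (c • (1 : X →L[ℂ] X) + S) := by
  have hcont : Continuous fun t : ℝ => c • (1 : X →L[ℂ] X) + (t : ℂ) • S := by fun_prop
  have hclopen : IsClopen {t : ℝ | Phi0 (c • (1 : X →L[ℂ] X) + (t : ℂ) • S)} := by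
    constructor
    · refine isClosed_of_closure_subset fun t ht => ?_
      exact phi0_closure _ (h t) (map_mem_closure
        (f := fun t : ℝ => c • (1 : X →L[ℂ] X) + (t : ℂ) • S) hcont ht fun s hs => hs) rfl
    · exact phi0_open.preimage hcont
  have huniv := hclopen.eq_univ ⟨0, by
    apply Phi0.of_isUnit
    simp only [Complex.ofReal_zero, zero_smul, add_zero]
    exact (isUnit_one).smul (Units.mk0 c hc)⟩
  have : (1 : ℝ) ∈ {t : ℝ | Phi0 (c • (1 : X →L[ℂ] X) + (t : ℂ) • S)} := by
    rw [huniv]; trivial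
  simpa using this

lemma coef_bound (x : ℕ → X) (f : ℕ → (X →L[ℂ] ℂ)) (hf1 : ∀ n, ‖f n‖ ≤ 1)
    (hfx : ∀ n, f n (x n) = 1) (hx1 : ∀ n, ‖x n‖ ≤ 1) (hz : ∀ m n, m < n → f m (x n) = 0)
    (a : ℕ → ℂ) (N : ℕ) (k : ℕ) : k < N →
    ‖a k‖ ≤ 2 ^ k * ‖∑ i ∈ Finset.range N, a i • x i‖ := by
  induction k using Nat.strong_induction_on with
  | _ k ih =>
  intro hk
  set z := ∑ i ∈ Finset.range N, a i • x i with hzdef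
  have h1 : f k z = ∑ i ∈ Finset.range (k + 1), a i * f k (x i) := by
    rw [hzdef, map_sum]
    simp only [map_smul, smul_eq_mul]
    symm
    apply Finset.sum_subset
    · intro i hi; simp at hi ⊢; omega
    · intro i _ hi
      rw [hz k i (by simp at hi; omega), mul_zero]
  rw [Finset.sum_range_succ, hfx, mul_one] at h1
  have h2 : a k = f k z - ∑ i ∈ Finset.range k, a i * f k (x i) := by rw [h1]; ring
  have h3 : ‖f k z‖ ≤ ‖z‖ := ((f k).le_opNorm z).trans
    (mul_le_of_le_one_left (norm_nonneg _) (hf1 k))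
  have h4 : ‖∑ i ∈ Finset.range k, a i * f k (x i)‖ ≤ ∑ i ∈ Finset.range k, 2 ^ i * ‖z‖ := by
    refine norm_sum_le_of_le _ fun i hi => ?_
    have hi' := Finset.mem_range.1 hi
    have h5 : ‖f k (x i)‖ ≤ 1 := ((f k).le_opNorm _).trans
      (mul_le_one₀ (hf1 k) (norm_nonneg _) (hx1 i))
    rw [norm_mul]
    exact (mul_le_of_le_one_right (norm_nonneg _) h5).trans (ih i hi' (by omega))
  have h6 : ∑ i ∈ Finset.range k, (2 : ℝ) ^ i * ‖z‖ = (2 ^ k - 1) * ‖z‖ := by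
    rw [← Finset.sum_mul, geom_sum_eq (by norm_num)]; norm_num
  rw [h2]
  refine (norm_sub_le _ _).trans ?_
  rw [h6] at h4
  linarith

lemma kato (A : X →L[ℂ] X) (ε : ℝ) (hε : 0 < ε) :
    (∃ s : Finset (X →L[ℂ] ℂ), ∃ δ : ℝ, 0 < δ ∧
      ∀ x, (∀ f ∈ s, f x = 0) → δ * ‖x‖ ≤ ‖A x‖) ∨
    ∃ M : Submodule ℂ X, ¬ FiniteDimensional ℂ M ∧ ∀ x ∈ M, ‖A x‖ ≤ 2 * ε * ‖x‖ := by
  classical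
  by_cases h : ∃ s : Finset (X →L[ℂ] ℂ), ∃ δ : ℝ, 0 < δ ∧
      ∀ x, (∀ f ∈ s, f x = 0) → δ * ‖x‖ ≤ ‖A x‖
  · exact Or.inl h
  right
  push Not at h
  obtain ⟨g, hgP, hgr⟩ := exists_seq_of_forall_finset_exists
    (α := X × (X →L[ℂ] ℂ) × ℕ)
    (fun p => ‖p.1‖ = 1 ∧ ‖p.2.1‖ = 1 ∧ p.2.1 p.1 = 1 ∧ ‖A p.1‖ ≤ ε * (1 / 4) ^ p.2.2)
    (fun p q => p.2.1 q.1 = 0 ∧ p.2.2 < q.2.2) (by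
      intro s _
      let n := s.sup (fun p => p.2.2) + 1
      obtain ⟨x, hx0, hx⟩ := h (s.image fun p => p.2.1) (ε * (1 / 4) ^ n) (by positivity)
      have hxne : x ≠ 0 := by rintro rfl; simp at hx
      have hn : 0 < ‖x‖ := norm_pos_iff.2 hxne
      have h1 : ‖((‖x‖⁻¹ : ℝ) : ℂ) • x‖ = 1 := by rw [norm_smul]; simp [hn.ne']
      obtain ⟨f, hf1, hfx⟩ := exists_dual_vector ℂ (((‖x‖⁻¹ : ℝ) : ℂ) • x) (by rw [h1]; simp)
      refine ⟨(((‖x‖⁻¹ : ℝ) : ℂ) • x, f, n), ⟨h1, hf1, ?_, ?_⟩, ?_⟩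
      · change f _ = 1
        rw [hfx, h1]; simp
      · rw [map_smul, norm_smul]
        simp only [Complex.norm_real, norm_inv, norm_norm]
        rw [inv_mul_le_iff₀ hn, mul_comm]
        exact hx.le
      · intro p hp
        refine ⟨?_, ?_⟩
        · rw [map_smul, hx0 _ (Finset.mem_image_of_mem _ hp), smul_zero]
        · exact Nat.lt_succ_of_le (Finset.le_sup (f := fun p : X × (X →L[ℂ] ℂ) × ℕ => p.2.2) hp))
  let x : ℕ → X := fun n => (g n).1
  let f : ℕ → (X →L[ℂ] ℂ) := fun n => (g n).2.1
  have hmono : StrictMono fun n => (g n).2.2 := fun m n hmn => (hgr m n hmn).2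
  have hxA : ∀ n, ‖A (x n)‖ ≤ ε * (1 / 4) ^ n := fun n =>
    (hgP n).2.2.2.trans (by
      gcongr ε * ?_
      exact pow_le_pow_of_le_one (by norm_num) (by norm_num) (hmono.id_le n))
  have hcb := coef_bound x f (fun n => (hgP n).2.1.le) (fun n => (hgP n).2.2.1)
    (fun n => (hgP n).1.le) (fun m n hmn => (hgr m n hmn).1)
  have hli : LinearIndependent ℂ x := by
    rw [linearIndependent_iff]
    intro l hl
    obtain ⟨N, hN⟩ := l.support.exists_nat_subset_range
    have hsum : ∑ i ∈ Finset.range N, l i • x i = 0 := by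
      rw [← hl, Finsupp.linearCombination_apply]
      exact (Finsupp.sum_of_support_subset l hN (fun i a => a • x i) (by simp)).symm
    ext i
    by_cases hi : i < N
    · have := hcb l N i hi
      rw [hsum] at this
      simpa using this
    · by_contra h0
      exact hi (Finset.mem_range.1 (hN (Finsupp.mem_support_iff.2 h0)))
  refine ⟨Submodule.span ℂ (Set.range x), ?_, ?_⟩
  · intro hfin
    have h2 := (linearIndependent_span hli).finite
    exact not_finite ℕ
  · intro z hz
    obtain ⟨l, rfl⟩ := Finsupp.mem_span_range_iff_exists_finsupp.1 hz
    obtain ⟨N, hN⟩ := l.support.exists_nat_subset_range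
    have hsum : (l.sum fun i a => a • x i) = ∑ i ∈ Finset.range N, l i • x i :=
      Finsupp.sum_of_support_subset l hN (fun i a => a • x i) (by simp)
    rw [hsum]
    set z := ∑ i ∈ Finset.range N, l i • x i with hzdef
    calc ‖A z‖ ≤ ∑ i ∈ Finset.range N, (1 / 2 : ℝ) ^ i * (ε * ‖z‖) := by
          rw [hzdef, map_sum, ← hzdef]
          refine norm_sum_le_of_le _ fun i hi => ?_
          rw [map_smul, norm_smul]
          calc ‖l i‖ * ‖A (x i)‖ ≤ (2 ^ i * ‖z‖) * (ε * (1 / 4) ^ i) := by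
                gcongr
                · exact hcb l N i (Finset.mem_range.1 hi)
                · exact hxA i
            _ = ((2 : ℝ) * (1 / 4)) ^ i * (ε * ‖z‖) := by rw [mul_pow]; ring
            _ = _ := by norm_num
      _ = (∑ i ∈ Finset.range N, (1 / 2 : ℝ) ^ i) * (ε * ‖z‖) := by rw [Finset.sum_mul]
      _ ≤ 2 * (ε * ‖z‖) := by
          gcongr
          exact sum_geometric_two_le N
      _ = 2 * ε * ‖z‖ := by ring

lemma prp_of_finset [CompleteSpace X] (A : X →L[ℂ] X) (s : Finset (X →L[ℂ] ℂ)) (δ : ℝ)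
    (hδ : 0 < δ) (h : ∀ x, (∀ f ∈ s, f x = 0) → δ * ‖x‖ ≤ ‖A x‖) : Prp A := by
  let L : X →L[ℂ] (s → ℂ) := ContinuousLinearMap.pi fun f => (f : X →L[ℂ] ℂ)
  have hL : ∀ x (f : s), L x f = (f : X →L[ℂ] ℂ) x := fun x f => rfl
  obtain ⟨g, hg⟩ := (L : X →ₗ[ℂ] (s → ℂ)).rangeRestrict.exists_rightInverse_of_surjective
    (LinearMap.range_rangeRestrict _)
  let gc := LinearMap.toContinuousLinearMap g
  have hgx : ∀ x, L (gc ⟨L x, ⟨x, rfl⟩⟩) = L x := fun x => by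
    have := congrArg Subtype.val (LinearMap.congr_fun hg ⟨L x, ⟨x, rfl⟩⟩)
    exact this
  let Q : X →L[ℂ] X := gc ∘L (L.codRestrict (LinearMap.range (L : X →ₗ[ℂ] (s → ℂ)))
    fun x => ⟨x, rfl⟩)
  have hQ : ∀ x, L (Q x) = L x := hgx
  have hQfin : FiniteDimensional ℂ (LinearMap.range (Q : X →ₗ[ℂ] X)) := by
    have : LinearMap.range (Q : X →ₗ[ℂ] X) ≤ LinearMap.range g := by
      rintro _ ⟨x, rfl⟩
      exact ⟨_, rfl⟩
    exact Submodule.finiteDimensional_of_le this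
  have hest : ∀ x, δ * ‖x - Q x‖ ≤ ‖A (x - Q x)‖ := fun x => h _ fun f hf => by
    have := congrFun (hQ x) ⟨f, hf⟩
    rw [hL, hL] at this
    rw [map_sub, sub_eq_zero]; exact this.symm
  rintro x ⟨R, hR⟩ y hy
  set E := LinearMap.range (Q : X →ₗ[ℂ] X) with hE
  have hQE : ∀ x, Q x ∈ E := fun x => ⟨x, rfl⟩
  have : ProperSpace E := FiniteDimensional.proper ℂ E
  obtain ⟨a, -, φ, hφ, ha⟩ := tendsto_subseq_of_bounded
    (Metric.isBounded_closedBall (x := (0 : E)) (r := ‖Q‖ * R))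
    (x := fun n => (⟨Q (x n), hQE _⟩ : E)) (fun n => by
      rw [mem_closedBall_zero_iff]
      exact (Q.le_opNorm _).trans (by gcongr; exact hR n))
  have ha' : Tendsto (fun n => Q (x (φ n))) atTop (𝓝 (a : X)) :=
    (continuous_subtype_val.tendsto a).comp ha
  have h2 : Tendsto (fun n => A (x (φ n) - Q (x (φ n)))) atTop (𝓝 (y - A a)) := by
    have := (hy.comp hφ.tendsto_atTop).sub ((A.continuous.tendsto _).comp ha')
    refine this.congr fun n => by simp
  have h3 : CauchySeq fun n => x (φ n) - Q (x (φ n)) := by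
    rw [Metric.cauchySeq_iff']
    intro ε hε
    obtain ⟨N, hN⟩ := Metric.cauchySeq_iff'.1 h2.cauchySeq (δ * ε) (by positivity)
    refine ⟨N, fun n hn => ?_⟩
    have h4 := hN n hn
    rw [dist_eq_norm] at h4 ⊢
    have h5 := hest (x (φ n) - x (φ N))
    have e1 : x (φ n) - x (φ N) - Q (x (φ n) - x (φ N)) =
      (x (φ n) - Q (x (φ n))) - (x (φ N) - Q (x (φ N))) := by rw [map_sub]; abel
    rw [e1, map_sub A] at h5
    exact lt_of_mul_lt_mul_left (h5.trans_lt h4) hδ.le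
  obtain ⟨b, hb⟩ := cauchySeq_tendsto_of_complete h3
  refine ⟨b + a, φ, hφ, ?_⟩
  refine (hb.add ha').congr fun n => by simp

lemma prp_ss [CompleteSpace X] (S : X →L[ℂ] X) (hS : StrictlySingular S) (c : ℂ) (hc : c ≠ 0)
    (t : ℝ) : Prp (c • (1 : X →L[ℂ] X) + (t : ℂ) • S) := by
  have hc' : 0 < ‖c‖ := norm_pos_iff.2 hc
  rcases kato (c • (1 : X →L[ℂ] X) + (t : ℂ) • S) (‖c‖ / 4) (by positivity) with
    ⟨s, δ, hδ, h⟩ | ⟨M, hM, h⟩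
  · exact prp_of_finset _ s δ hδ h
  · refine absurd ⟨‖c‖ / (2 * (|t| + 1)), by positivity, fun x hx => ?_⟩ (hS M hM)
    have h1 : ‖c • x + (t : ℂ) • S x‖ ≤ 2 * (‖c‖ / 4) * ‖x‖ := h x hx
    have h2 : ‖c • x‖ ≤ ‖c • x + (t : ℂ) • S x‖ + ‖(t : ℂ) • S x‖ := by
      have := norm_sub_le (c • x + (t : ℂ) • S x) ((t : ℂ) • S x)
      simpa using this
    rw [norm_smul, norm_smul, Complex.norm_real, Real.norm_eq_abs] at h2
    rw [div_mul_eq_mul_div, div_le_iff₀ (by positivity)]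
    nlinarith [norm_nonneg (S x)]

/-- Fredholm alternative. -/
lemma alternative [CompleteSpace X] (S : X →L[ℂ] X) (hS : StrictlySingular S) (c : ℂ)
    (hc : c ≠ 0) : IsUnit (c • (1 : X →L[ℂ] X) + S) ∨
      ∃ ψ : X →L[ℂ] ℂ, ψ ≠ 0 ∧ ∀ x, ψ ((c • (1 : X →L[ℂ] X) + S) x) = 0 := by
  rcases (phi0_path c hc S (prp_ss S hS c hc)).alt with h | h
  · exact Or.inl h
  · exact Or.inr h.2

lemma pow_inv_tendsto [CompleteSpace X] [Nontrivial X] (u : (X →L[ℂ] X)ˣ)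
    (h : ∀ μ : ℂ, ‖μ‖ ≤ 1 → IsUnit ((u : X →L[ℂ] X) - μ • (1 : X →L[ℂ] X))) :
    Tendsto (fun n : ℕ => ‖((u⁻¹ : (X →L[ℂ] X)ˣ) : X →L[ℂ] X) ^ n‖) atTop (𝓝 0) := by
  set D : X →L[ℂ] X := ((u⁻¹ : (X →L[ℂ] X)ˣ) : X →L[ℂ] X) with hD
  have hsp : ∀ z ∈ spectrum ℂ D, ‖z‖₊ < (1 : NNReal) := by
    intro z hz
    rw [hD, ← spectrum.map_inv, Set.mem_inv] at hz
    by_contra! h1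
    have h1' : 1 ≤ ‖z‖ := h1
    have h2 := h z⁻¹ (by rw [norm_inv]; exact inv_le_one_of_one_le₀ h1')
    rw [spectrum.mem_iff, ← IsUnit.neg_iff, neg_sub, Algebra.algebraMap_eq_smul_one] at hz
    exact hz h2
  have hr : spectralRadius ℂ D < 1 := by
    simpa using spectrum.spectralRadius_lt_of_forall_lt D hsp
  obtain ⟨q, hq1, hq2⟩ := ENNReal.lt_iff_exists_nnreal_btwn.1 hr
  have hq2' : (q : ℝ) < 1 := by exact_mod_cast hq2
  have hev := (spectrum.pow_nnnorm_pow_one_div_tendsto_nhds_spectralRadius D).eventually_lt_const hq1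
  refine squeeze_zero' (Eventually.of_forall fun n => norm_nonneg _) ?_
    (tendsto_pow_atTop_nhds_zero_of_lt_one q.2 hq2')
  filter_upwards [hev, eventually_gt_atTop 0] with n hn hn0
  have h3 : ((‖D ^ n‖₊ : ENNReal)) ≤ (q : ENNReal) ^ n := by
    have h4 := pow_le_pow_left' hn.le n
    rwa [← ENNReal.rpow_natCast, ← ENNReal.rpow_mul, one_div,
      inv_mul_cancel₀ (by exact_mod_cast hn0.ne'), ENNReal.rpow_one] at h4
  exact_mod_cast h3

lemma jset_functional (T : X →L[ℂ] X) (ψ : X →L[ℂ] ℂ) (hψ : ψ ≠ 0) (μ : ℂ) (hμ : ‖μ‖ ≤ 1)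
    (h : ∀ x, ψ (T x) = μ * ψ x) (x : X) : interior (JSet T x) = ∅ := by
  have hpow : ∀ n x, ψ ((T ^ n) x) = μ ^ n * ψ x := by
    intro n
    induction n with
    | zero => intro x; simp
    | succ n ih =>
      intro x
      rw [pow_succ, mul_apply_eq_comp, ih, h]; ring
  obtain ⟨r, hr⟩ : ∃ r : ℝ, ∀ y ∈ JSet T x, ‖ψ y‖ = r := by
    have key : ∀ y ∈ JSet T x, ∃ k : ℕ → ℕ, StrictMono k ∧ ∃ b : ℕ → ℝ,
        Tendsto b atTop (𝓝 ‖ψ x‖) ∧ Tendsto (fun n => ‖μ‖ ^ k n * b n) atTop (𝓝 ‖ψ y‖) := by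
      rintro y ⟨k, hk, u, hu, hy⟩
      refine ⟨k, hk, fun n => ‖ψ (u n)‖, ((ψ.continuous.tendsto x).comp hu).norm, ?_⟩
      refine (((ψ.continuous.tendsto y).comp hy).norm).congr fun n => ?_
      rw [Function.comp_apply, hpow, norm_mul, norm_pow]
    rcases hμ.lt_or_eq with hlt | heq
    · refine ⟨0, fun y hy => ?_⟩
      obtain ⟨k, hk, b, hb, hy⟩ := key y hy
      have := ((tendsto_pow_atTop_nhds_zero_of_lt_one (norm_nonneg μ) hlt).comp
        hk.tendsto_atTop).mul hb
      rw [zero_mul] at this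
      exact tendsto_nhds_unique hy this
    · refine ⟨‖ψ x‖, fun y hy => ?_⟩
      obtain ⟨k, hk, b, hb, hy⟩ := key y hy
      simp only [heq, one_pow, one_mul] at hy
      exact tendsto_nhds_unique hy hb
  have hsurj : Function.Surjective ψ := by
    obtain ⟨v, hv⟩ : ∃ v, ψ v ≠ 0 := by
      by_contra! h0
      exact hψ (ContinuousLinearMap.ext h0)
    intro z
    exact ⟨(z * (ψ v)⁻¹) • v, by simp [hv]⟩
  have hopen : IsOpenMap ψ := by
    exact (ψ : X →ₗ[ℂ] ℂ).isOpenMap_of_finiteDimensional hsurj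
  rw [Set.eq_empty_iff_forall_notMem]
  intro y hy
  have h1 : ψ '' interior (JSet T x) ⊆ interior (Metric.sphere 0 r) := by
    refine interior_maximal ?_ (hopen _ isOpen_interior)
    rintro _ ⟨w, hw, rfl⟩
    simpa using hr w (interior_subset hw)
  rw [interior_sphere'] at h1
  exact h1 ⟨y, hy, rfl⟩

end JProof

theorem stmt_0 {X : Type*} [NormedAddCommGroup X] [NormedSpace ℂ X] [CompleteSpace X]
    (hX : ¬ FiniteDimensional ℂ X) (S : X →L[ℂ] X) (hS : StrictlySingular S)
    (lam : ℂ) (hlam : 1 < ‖lam‖) (T : X →L[ℂ] X)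
    (hT : T = lam • ContinuousLinearMap.id ℂ X + S) :
    ∀ x : X, x ≠ 0 → interior (JSet T x) = ∅ := by
  intro x hx
  have hnt : Nontrivial X := ⟨x, 0, hx⟩
  by_cases hex : ∃ μ : ℂ, ‖μ‖ ≤ 1 ∧ ∃ ψ : X →L[ℂ] ℂ, ψ ≠ 0 ∧ ∀ z, ψ (T z) = μ * ψ z
  · obtain ⟨μ, hμ, ψ, hψ, h⟩ := hex
    exact JProof.jset_functional T ψ hψ μ hμ h x
  have hunit : ∀ μ : ℂ, ‖μ‖ ≤ 1 → IsUnit (T - μ • (1 : X →L[ℂ] X)) := by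
    intro μ hμ
    have hc : lam - μ ≠ 0 := by
      intro h0
      rw [sub_eq_zero.1 h0] at hlam
      linarith
    have he : T - μ • (1 : X →L[ℂ] X) = (lam - μ) • (1 : X →L[ℂ] X) + S := by
      rw [hT, sub_smul, ← ContinuousLinearMap.one_def]; abel
    rcases JProof.alternative S hS (lam - μ) hc with h | ⟨ψ, hψ, h⟩
    · rw [he]; exact h
    · refine absurd ⟨μ, hμ, ψ, hψ, fun z => ?_⟩ hex
      have h1 := h z
      rw [← he] at h1
      have h2 : (T - μ • (1 : X →L[ℂ] X)) z = T z - μ • z := rfl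
      rw [h2, map_sub, map_smul, smul_eq_mul, sub_eq_zero] at h1
      exact h1
  have hTu : IsUnit T := by simpa using hunit 0 (by simp)
  obtain ⟨u, rfl⟩ := hTu
  have hlim := JProof.pow_inv_tendsto u hunit
  have hempty : JSet (u : X →L[ℂ] X) x = ∅ := by
    rw [Set.eq_empty_iff_forall_notMem]
    rintro y ⟨k, hk, v, hv, hy⟩
    apply hx
    refine tendsto_nhds_unique hv ?_
    rw [tendsto_zero_iff_norm_tendsto_zero]
    have h1 := (hlim.comp hk.tendsto_atTop).mul hy.norm
    rw [zero_mul] at h1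
    refine squeeze_zero (fun n => norm_nonneg _) (fun n => ?_) h1
    have h2 : v n = (((u⁻¹ : (X →L[ℂ] X)ˣ) : X →L[ℂ] X) ^ k n)
        (((u : X →L[ℂ] X) ^ k n) (v n)) := by
      rw [← mul_apply_eq_comp, ← Units.val_pow_eq_pow_val, ← Units.val_pow_eq_pow_val,
        ← Units.val_mul, inv_pow, inv_mul_cancel]
      rfl
    have h3 := ContinuousLinearMap.le_opNorm (((u⁻¹ : (X →L[ℂ] X)ˣ) : X →L[ℂ] X) ^ k n)
      (((u : X →L[ℂ] X) ^ k n) (v n))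
    rw [← h2] at h3
    exact h3
  rw [hempty, interior_empty]
end

section
/- Let X be a complex infinite-dimensional Banach space and let T = λ·I + S be a bounded linear operator on X, where S is strictly singular and λ ∈ ℂ satisfies |λ| > 1. Then T is zero J-class if and only if the spectrum σ(T) is contained in the complement of the closed unit disk, i.e. σ(T) ⊂ {μ ∈ ℂ : |μ| > 1}. -/
open Filter Topology

/-- `T` is zero J-class if `J_T(0) = X` and `J_T(x) ≠ X` for every nonzero `x`. -/
def ZeroJClass {𝕜 X : Type*} [NontriviallyNormedField 𝕜] [NormedAddCommGroup X]
    [NormedSpace 𝕜 X] (T : X →L[𝕜] X) : Prop :=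
  JSet T 0 = Set.univ ∧ ∀ x : X, x ≠ 0 → JSet T x ≠ Set.univ

section helpers

variable {X : Type*} [NormedAddCommGroup X] [NormedSpace ℂ X]

/-- Kato's construction: if `A` is bounded below on no finite-codimensional subspace cut out by
finitely many functionals, then `A` is small on some infinite-dimensional subspace. -/
theorem kato_small (A : X →L[ℂ] X)
    (H : ∀ F : Finset (X →L[ℂ] ℂ), ∀ ε : ℝ, 0 < ε →
      ∃ x : X, ‖x‖ = 1 ∧ (∀ f ∈ F, f x = 0) ∧ ‖A x‖ ≤ ε) (ε : ℝ) (hε : 0 < ε) :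
    ∃ M : Submodule ℂ X, ¬ FiniteDimensional ℂ M ∧ ∀ x ∈ M, ‖A x‖ ≤ ε * ‖x‖ := by
  classical
  obtain ⟨s, hP, hr⟩ := exists_seq_of_forall_finset_exists
    (α := X × (X →L[ℂ] ℂ) × ℝ)
    (fun p => ‖p.1‖ = 1 ∧ ‖p.2.1‖ ≤ 1 ∧ p.2.1 p.1 = 1 ∧ ‖A p.1‖ ≤ p.2.2 ∧ 0 < p.2.2 ∧
      p.2.2 ≤ ε / 2)
    (fun p q => p.2.1 q.1 = 0 ∧ q.2.2 ≤ p.2.2 / 4)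
    (by
      intro s hs
      have hδ : ∃ δ : ℝ, 0 < δ ∧ δ ≤ ε / 2 ∧ ∀ p ∈ s, δ ≤ p.2.2 / 4 := by
        clear H
        induction s using Finset.induction_on with
        | empty => exact ⟨ε / 2, by positivity, le_rfl, by simp⟩
        | insert a t hat ih =>
          obtain ⟨δ, h1, h2, h3⟩ := ih (fun x hx => hs x (Finset.mem_insert_of_mem hx))
          have ha := (hs a (Finset.mem_insert_self _ _)).2.2.2.2.1
          refine ⟨min δ (a.2.2 / 4), lt_min h1 (by positivity), (min_le_left _ _).trans h2, ?_⟩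
          intro p hp
          rcases Finset.mem_insert.1 hp with rfl | hp
          · exact min_le_right _ _
          · exact (min_le_left _ _).trans (h3 p hp)
      obtain ⟨δ, h1, h2, h3⟩ := hδ
      obtain ⟨x, hx1, hx2, hx3⟩ := H (s.image (fun p => p.2.1)) δ h1
      obtain ⟨g, hg1, hg2⟩ := exists_dual_vector (𝕜 := ℂ) x (by rw [hx1]; exact one_ne_zero)
      refine ⟨(x, g, δ), ⟨hx1, hg1.le, by simp [hg2, hx1], hx3, h1, h2⟩, ?_⟩
      intro p hp
      exact ⟨hx2 _ (Finset.mem_image_of_mem _ hp), h3 p hp⟩)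
  set x : ℕ → X := fun n => (s n).1 with hx
  set f : ℕ → (X →L[ℂ] ℂ) := fun n => (s n).2.1 with hf
  have hx1 : ∀ n, ‖x n‖ = 1 := fun n => (hP n).1
  have hf1 : ∀ n, ‖f n‖ ≤ 1 := fun n => (hP n).2.1
  have hfx : ∀ n, f n (x n) = 1 := fun n => (hP n).2.2.1
  have hfz : ∀ m n, m < n → f m (x n) = 0 := fun m n h => (hr m n h).1
  have hδ : ∀ n, (s n).2.2 ≤ ε / 2 * (1 / 4) ^ n := by
    intro n
    induction n with
    | zero => simpa using (hP 0).2.2.2.2.2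
    | succ n ih =>
      have := (hr n (n+1) (Nat.lt_succ_self n)).2
      rw [pow_succ]; linarith
  have hA : ∀ n, ‖A (x n)‖ ≤ ε / 2 * (1 / 4) ^ n := fun n => (hP n).2.2.2.1.trans (hδ n)
  have hfle : ∀ n y, ‖f n y‖ ≤ ‖y‖ := fun n y => by
    have := (f n).le_of_opNorm_le (hf1 n) y
    simpa using this
  -- coefficient bounds
  have coef : ∀ (a : ℕ → ℂ) (N k : ℕ), k < N →
      ‖a k‖ ≤ 2 ^ k * ‖∑ i ∈ Finset.range N, a i • x i‖ := by
    intro a N k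
    induction k using Nat.strong_induction_on with
    | _ k ih =>
      intro hk
      set y := ∑ i ∈ Finset.range N, a i • x i with hy
      have e1 : f k y = ∑ i ∈ Finset.range (k + 1), a i * f k (x i) := by
        rw [hy, map_sum]
        simp only [map_smul, smul_eq_mul]
        symm
        apply Finset.sum_subset
        · intro i hi; simp at hi ⊢; omega
        · intro i _ hi
          simp at hi
          rw [hfz k i (by omega), mul_zero]
      rw [Finset.sum_range_succ, hfx, mul_one] at e1
      have e2 : a k = f k y - ∑ i ∈ Finset.range k, a i * f k (x i) := by rw [e1]; ring
      have e3 : ‖∑ i ∈ Finset.range k, a i * f k (x i)‖ ≤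
          ∑ i ∈ Finset.range k, 2 ^ i * ‖y‖ := by
        refine norm_sum_le_of_le _ (fun i hi => ?_)
        have hi' := Finset.mem_range.1 hi
        rw [norm_mul]
        have h1 := ih i hi' (hi'.trans hk)
        have h2 : ‖f k (x i)‖ ≤ 1 := (hfle k (x i)).trans (hx1 i).le
        nlinarith [norm_nonneg (a i), norm_nonneg (f k (x i))]
      have e4 : ∑ i ∈ Finset.range k, (2 : ℝ) ^ i = 2 ^ k - 1 := by
        rw [geom_sum_eq (by norm_num)]; norm_num
      rw [← Finset.sum_mul, e4] at e3
      calc ‖a k‖ ≤ ‖f k y‖ + ‖∑ i ∈ Finset.range k, a i * f k (x i)‖ := by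
            rw [e2]; exact norm_sub_le _ _
        _ ≤ ‖y‖ + (2 ^ k - 1) * ‖y‖ := add_le_add (hfle k y) e3
        _ = 2 ^ k * ‖y‖ := by ring
  have lc : ∀ (l : ℕ →₀ ℂ) (N : ℕ), l.support ⊆ Finset.range N →
      Finsupp.linearCombination ℂ x l = ∑ i ∈ Finset.range N, l i • x i := by
    intro l N h
    rw [Finsupp.linearCombination_apply, Finsupp.sum_of_support_subset _ h _ (by simp)]
  have big : ∀ (l : ℕ →₀ ℂ), ∃ N, l.support ⊆ Finset.range N := fun l =>
    Finset.exists_nat_subset_range _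
  have li : LinearIndependent ℂ x := by
    rw [linearIndependent_iff]
    intro l hl
    obtain ⟨N, hN⟩ := big l
    rw [lc l N hN] at hl
    ext k
    by_cases hk : k ∈ l.support
    · have := coef l N k (Finset.mem_range.1 (hN hk))
      rw [hl] at this
      simpa using this
    · simpa using hk
  refine ⟨Submodule.span ℂ (Set.range x), ?_, ?_⟩
  · intro hfin
    have li2 : LinearIndependent ℂ
        (fun n => (⟨x n, Submodule.subset_span ⟨n, rfl⟩⟩ : Submodule.span ℂ (Set.range x))) :=
      LinearIndependent.of_comp (Submodule.subtype _) li
    have := li2.finite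
    exact not_finite ℕ
  · intro y hy
    rw [Finsupp.mem_span_range_iff_exists_finsupp] at hy
    obtain ⟨l, hl⟩ := hy
    obtain ⟨N, hN⟩ := big l
    have hl' : y = ∑ i ∈ Finset.range N, l i • x i := by
      rw [← lc l N hN, Finsupp.linearCombination_apply, hl]
    have e : ‖A y‖ ≤ ∑ i ∈ Finset.range N, (ε / 2 * ‖y‖) * (1 / 2) ^ i := by
      conv_lhs => rw [hl', map_sum]
      refine norm_sum_le_of_le _ (fun i hi => ?_)
      rw [map_smul, norm_smul]
      have h1 := coef l N i (Finset.mem_range.1 hi)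
      rw [← hl'] at h1
      calc ‖l i‖ * ‖A (x i)‖ ≤ (2 ^ i * ‖y‖) * (ε / 2 * (1 / 4) ^ i) :=
            mul_le_mul h1 (hA i) (norm_nonneg _) (by positivity)
        _ = (ε / 2 * ‖y‖) * (2 ^ i * (1 / 4) ^ i) := by ring
        _ = _ := by rw [← mul_pow]; norm_num
    rw [← Finset.mul_sum] at e
    have := sum_geometric_two_le N
    have h0 : 0 ≤ ε / 2 * ‖y‖ := by positivity
    nlinarith

theorem closed_range_of_ss [CompleteSpace X] (S : X →L[ℂ] X) (hS : StrictlySingular S)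
    (c : ℂ) (hc : c ≠ 0) (A : X →L[ℂ] X) (hA : ∀ x, A x = c • x + S x) :
    IsClosed (A.range : Set X) := by
  classical
  have hc' : 0 < ‖c‖ := norm_pos_iff.2 hc
  by_cases H : ∀ F : Finset (X →L[ℂ] ℂ), ∀ ε : ℝ, 0 < ε →
      ∃ x : X, ‖x‖ = 1 ∧ (∀ f ∈ F, f x = 0) ∧ ‖A x‖ ≤ ε
  · exfalso
    obtain ⟨M, hM, hM2⟩ := kato_small A H (‖c‖ / 2) (by positivity)
    refine hS M hM ⟨‖c‖ / 2, by positivity, fun x hx => ?_⟩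
    have h1 := hM2 x hx
    have h2 : ‖c • x‖ ≤ ‖A x‖ + ‖S x‖ := by
      have : c • x = A x - S x := by rw [hA]; abel
      rw [this]; exact norm_sub_le _ _
    rw [norm_smul] at h2
    linarith
  · push Not at H
    obtain ⟨F, ε, hε, H⟩ := H
    let N : Submodule ℂ X :=
      LinearMap.ker (LinearMap.pi (fun f : F => ((f : X →L[ℂ] ℂ) : X →ₗ[ℂ] ℂ)))
    have hmem : ∀ x, x ∈ N ↔ ∀ f ∈ F, f x = 0 := by
      intro x
      simp only [N, LinearMap.mem_ker, funext_iff, LinearMap.pi_apply]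
      simp
    have hNc : IsClosed (N : Set X) := by
      have : (N : Set X) = ⋂ f ∈ F, {x : X | f x = 0} := by
        ext x; simp [hmem]
      rw [this]
      exact isClosed_biInter fun f _ => isClosed_eq f.continuous continuous_const
    have hcof : N.CoFG := Submodule.CoFG.ker _
    have bb : ∀ x ∈ N, ε * ‖x‖ ≤ ‖A x‖ := by
      intro x hx
      by_cases h0 : x = 0
      · simp [h0]
      have hn : 0 < ‖x‖ := norm_pos_iff.2 h0
      have := H (((‖x‖⁻¹ : ℝ) : ℂ) • x) (by
        rw [norm_smul, Complex.norm_real, norm_inv, norm_norm, inv_mul_cancel₀ hn.ne'])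
        (fun f hf => by rw [map_smul, (hmem x).1 hx f hf, smul_zero])
      rw [map_smul, norm_smul, Complex.norm_real, norm_inv, norm_norm] at this
      have := this.le
      rw [inv_mul_eq_div, le_div_iff₀ hn] at this
      exact this
    have hcl : IsClosed (N.map (A : X →ₗ[ℂ] X) : Set X) := by
      haveI : CompleteSpace N := hNc.completeSpace_coe
      have anti : AntilipschitzWith (Real.toNNReal ε⁻¹) (A.comp N.subtypeL) := by
        refine AddMonoidHomClass.antilipschitz_of_bound _ (fun x => ?_)
        have := bb x x.2
        rw [Real.coe_toNNReal _ (by positivity), inv_mul_eq_div, le_div_iff₀ hε]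
        simpa [mul_comm] using this
      have := anti.isClosed_range (A.comp N.subtypeL).uniformContinuous
      convert this using 1
      ext y; simp
    exact LinearMap.isClosed_range_of_isClosed_map_of_finiteDimensional_quotient hcl

theorem exists_functional (p : Submodule ℂ X) (hp : IsClosed (p : Set X)) (x : X) (hx : x ∉ p) :
    ∃ φ : X →L[ℂ] ℂ, (∀ y ∈ p, φ y = 0) ∧ φ x ≠ 0 := by
  haveI : IsClosed (p : Set X) := hp
  have hne : p.mkQ x ≠ 0 := by simpa using hx
  obtain ⟨g, hg⟩ := SeparatingDual.exists_ne_zero (R := ℂ) hne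
  refine ⟨g.comp p.mkQL, fun y hy => ?_, hg⟩
  have : p.mkQ y = 0 := by simpa using hy
  have h2 : p.mkQL y = 0 := this
  simp [h2]

theorem functional_zero (T : X →L[ℂ] X) (hJ : JSet T 0 = Set.univ) (μ : ℂ) (hμ : ‖μ‖ ≤ 1)
    (φ : X →L[ℂ] ℂ) (h : ∀ x, φ (T x) = μ * φ x) (y : X) : φ y = 0 := by
  have hy : y ∈ JSet T 0 := hJ ▸ Set.mem_univ y
  obtain ⟨k, -, u, hu, hTu⟩ := hy
  have hpow : ∀ n x, φ ((T ^ n) x) = μ ^ n * φ x := by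
    intro n
    induction n with
    | zero => simp
    | succ n ih =>
      intro x
      rw [pow_succ, ContinuousLinearMap.mul_apply, ih, h, pow_succ, mul_assoc]
  have l1 : Tendsto (fun n => φ ((T ^ k n) (u n))) atTop (𝓝 (φ y)) :=
    (φ.continuous.tendsto y).comp hTu
  have l2 : Tendsto (fun n => φ ((T ^ k n) (u n))) atTop (𝓝 0) := by
    have l3 : Tendsto (fun n => ‖φ (u n)‖) atTop (𝓝 0) := by
      have := ((φ.continuous.tendsto 0).comp hu).norm
      simpa using this
    refine squeeze_zero_norm (fun n => ?_) l3
    rw [hpow, norm_mul, norm_pow]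
    exact mul_le_of_le_one_left (norm_nonneg _) (pow_le_one₀ (norm_nonneg _) hμ)
  exact tendsto_nhds_unique l1 l2

theorem jset_eigen (T : X →L[ℂ] X) (hJ : JSet T 0 = Set.univ) (μ : ℂ) (hμ : ‖μ‖ < 1)
    (x : X) (hx : T x = μ • x) : JSet T x = Set.univ := by
  ext y
  simp only [Set.mem_univ, iff_true]
  have hy : y ∈ JSet T 0 := hJ ▸ Set.mem_univ y
  obtain ⟨k, hk, u, hu, hTu⟩ := hy
  have hpow : ∀ n, (T ^ n) x = μ ^ n • x := by
    intro n
    induction n with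
    | zero => simp
    | succ n ih =>
      rw [pow_succ, ContinuousLinearMap.mul_apply, hx, map_smul, ih, smul_smul, pow_succ, mul_comm]
  refine ⟨k, hk, fun n => u n + x, by simpa using hu.add_const x, ?_⟩
  have l : Tendsto (fun n => μ ^ k n • x) atTop (𝓝 ((0 : ℂ) • x)) :=
    ((tendsto_pow_atTop_nhds_zero_of_norm_lt_one hμ).comp hk.tendsto_atTop).smul_const x
  have := hTu.add l
  simpa only [map_add, hpow, zero_smul, add_zero] using this

theorem unit_of_near [CompleteSpace X] (A : X →L[ℂ] X) (hA : Function.Surjective A)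
    (hB : ∀ δ : ℝ, 0 < δ → ∃ e : ℂ, ‖e‖ ≤ δ ∧ IsUnit (A + e • (1 : X →L[ℂ] X))) :
    IsUnit A := by
  obtain ⟨C, hC, hpre⟩ := A.exists_preimage_norm_le hA
  obtain ⟨e, he, ⟨B, hBe⟩⟩ := hB (1 / (4 * C)) (by positivity)
  set R : X →L[ℂ] X := ↑B⁻¹ with hR
  have hRB : ∀ x, R (A x + e • x) = x := by
    intro x
    have h1 : R * (B : X →L[ℂ] X) = 1 := B.inv_mul
    have := congrArg (fun L : X →L[ℂ] X => L x) h1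
    rw [hBe] at this
    simpa using this
  have heC : ‖e‖ * C ≤ 1 / 4 := by
    calc ‖e‖ * C ≤ 1 / (4 * C) * C := by gcongr
      _ = 1 / 4 := by field_simp
  have hb : ‖R‖ ≤ C + ‖e‖ * ‖R‖ * C := by
    refine R.opNorm_le_bound (by positivity) (fun y => ?_)
    obtain ⟨x, hx, hxn⟩ := hpre y
    have h1 : R y = x - e • R x := by
      have := hRB x
      rw [map_add, map_smul, hx] at this
      exact eq_sub_of_add_eq this
    calc ‖R y‖ ≤ ‖x‖ + ‖e • R x‖ := by rw [h1]; exact norm_sub_le _ _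
      _ ≤ ‖x‖ + ‖e‖ * (‖R‖ * ‖x‖) := by rw [norm_smul]; gcongr; exact R.le_opNorm x
      _ ≤ C * ‖y‖ + ‖e‖ * (‖R‖ * (C * ‖y‖)) := by gcongr
      _ = _ := by ring
  have hR0 := norm_nonneg R
  have hR2 : ‖R‖ ≤ 2 * C := by nlinarith
  have hlt : ‖e • R‖ < 1 := by
    rw [norm_smul]
    nlinarith [norm_nonneg e]
  have hu : IsUnit (1 - e • R) := isUnit_one_sub_of_norm_lt_one hlt
  have : A = (B : X →L[ℂ] X) * (1 - e • R) := by
    rw [mul_sub, mul_one, mul_smul_comm, hR, B.mul_inv, hBe]; abel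
  rw [this]
  exact B.isUnit.mul hu

theorem inv_pow_tendsto [CompleteSpace X] [Nontrivial X] (T : (X →L[ℂ] X)ˣ)
    (h : spectrum ℂ (T : X →L[ℂ] X) ⊆ {μ : ℂ | 1 < ‖μ‖}) :
    Tendsto (fun n : ℕ => ‖((T⁻¹ : (X →L[ℂ] X)ˣ) : X →L[ℂ] X) ^ n‖) atTop (𝓝 0) := by
  set R : X →L[ℂ] X := ((T⁻¹ : (X →L[ℂ] X)ˣ) : X →L[ℂ] X) with hR
  have hr : spectralRadius ℂ R < ((1 : NNReal) : ENNReal) := by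
    refine spectrum.spectralRadius_lt_of_forall_lt R (fun z hz => ?_)
    rw [hR, ← spectrum.map_inv, Set.mem_inv] at hz
    have h1 : 1 < ‖z⁻¹‖ := h hz
    rw [norm_inv] at h1
    have hz0 : 0 < ‖z‖ := by
      by_contra h0
      have : ‖z‖ = 0 := le_antisymm (not_lt.1 h0) (norm_nonneg _)
      rw [this] at h1; norm_num at h1
    have h2 : ‖z‖ < 1 := (one_lt_inv₀ hz0).1 h1
    exact_mod_cast h2
  obtain ⟨r, hr1, hr2⟩ := ENNReal.lt_iff_exists_nnreal_btwn.1 hr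
  have hr2' : r < 1 := by exact_mod_cast hr2
  have g := spectrum.pow_nnnorm_pow_one_div_tendsto_nhds_spectralRadius R
  have ev := g.eventually_lt_const hr1
  have l : Tendsto (fun n : ℕ => (r : ℝ) ^ n) atTop (𝓝 0) :=
    tendsto_pow_atTop_nhds_zero_of_lt_one r.2 (by exact_mod_cast hr2')
  refine squeeze_zero' (Eventually.of_forall fun n => norm_nonneg _) ?_ l
  filter_upwards [ev, eventually_gt_atTop 0] with n hn hn0
  have hn' : (0 : ℝ) < n := by exact_mod_cast hn0
  have : ((‖R ^ n‖₊ : NNReal) : ENNReal) < (r : ENNReal) ^ (n : ℝ) := by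
    rw [one_div] at hn
    have := ENNReal.rpow_lt_rpow hn hn'
    rwa [← ENNReal.rpow_mul, inv_mul_cancel₀ hn'.ne', ENNReal.rpow_one] at this
  rw [ENNReal.rpow_natCast] at this
  have h3 : ‖R ^ n‖₊ < r ^ n := by exact_mod_cast this
  exact_mod_cast h3.le

end helpers

theorem stmt_1 {X : Type*} [NormedAddCommGroup X] [NormedSpace ℂ X] [CompleteSpace X]
    (hX : ¬ FiniteDimensional ℂ X) (S : X →L[ℂ] X) (hS : StrictlySingular S)
    (lam : ℂ) (hlam : 1 < ‖lam‖) (T : X →L[ℂ] X)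
    (hT : T = lam • ContinuousLinearMap.id ℂ X + S) :
    ZeroJClass T ↔ spectrum ℂ T ⊆ {μ : ℂ | 1 < ‖μ‖} := by
  haveI : Nontrivial X := by
    by_contra hn
    rw [not_nontrivial_iff_subsingleton] at hn
    exact hX inferInstance
  constructor
  · rintro ⟨hJ, hJx⟩
    have surj : ∀ μ : ℂ, ‖μ‖ ≤ 1 → Function.Surjective (T - μ • (1 : X →L[ℂ] X)) := by
      intro μ hμ
      have hc : lam - μ ≠ 0 := by
        intro h0
        rw [sub_eq_zero] at h0
        rw [h0] at hlam
        linarith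
      have hcl := closed_range_of_ss S hS (lam - μ) hc (T - μ • (1 : X →L[ℂ] X)) (fun x => by
        simp [hT, sub_smul]; abel)
      intro y
      by_contra hy
      obtain ⟨φ, h1, h2⟩ := exists_functional _ hcl y (by
        simpa using hy)
      refine h2 (functional_zero T hJ μ hμ φ (fun x => ?_) y)
      have := h1 ((T - μ • (1 : X →L[ℂ] X)) x) ⟨x, rfl⟩
      simp [sub_eq_zero] at this
      exact this
    have unit1 : ∀ μ : ℂ, ‖μ‖ < 1 → IsUnit (T - μ • (1 : X →L[ℂ] X)) := by
      intro μ hμ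
      rw [ContinuousLinearMap.isUnit_iff_bijective]
      refine ⟨?_, surj μ hμ.le⟩
      rw [injective_iff_map_eq_zero]
      intro x hx
      by_contra hx0
      refine hJx x hx0 (jset_eigen T hJ μ hμ x ?_)
      simpa [sub_eq_zero] using hx
    intro μ hμ
    by_contra hle
    have hle : ‖μ‖ ≤ 1 := not_lt.1 hle
    have hu : IsUnit (T - μ • (1 : X →L[ℂ] X)) := by
      refine unit_of_near _ (surj μ hle) (fun δ hδ => ?_)
      set t : ℝ := min δ 1 with ht
      have ht0 : 0 < t := lt_min hδ one_pos
      have ht1 : t ≤ 1 := min_le_right _ _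
      refine ⟨(t : ℂ) * μ, ?_, ?_⟩
      · rw [norm_mul, Complex.norm_real, Real.norm_of_nonneg ht0.le]
        calc t * ‖μ‖ ≤ t := mul_le_of_le_one_right ht0.le hle
          _ ≤ δ := min_le_left _ _
      · have := unit1 (((1 - t : ℝ) : ℂ) * μ) (by
          rw [norm_mul, Complex.norm_real, Real.norm_of_nonneg (by linarith)]
          nlinarith [norm_nonneg μ])
        convert this using 1
        push_cast
        module
    rw [spectrum.mem_iff] at hμ
    apply hμ
    rw [← IsUnit.neg_iff, neg_sub, Algebra.algebraMap_eq_smul_one]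
    exact hu
  · intro h
    have h0 : IsUnit T := by
      by_contra hn
      have : (0 : ℂ) ∈ spectrum ℂ T := spectrum.zero_mem ℂ hn
      have := h this
      simp at this
      linarith
    obtain ⟨U, rfl⟩ := h0
    have lim := inv_pow_tendsto U h
    set R : X →L[ℂ] X := ((U⁻¹ : (X →L[ℂ] X)ˣ) : X →L[ℂ] X) with hR
    have hc : Commute (U : X →L[ℂ] X) R := by
      rw [Commute, SemiconjBy, hR, U.mul_inv, U.inv_mul]
    have e1 : ∀ n (x : X), ((U : X →L[ℂ] X) ^ n) ((R ^ n) x) = x := by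
      intro n x
      rw [← ContinuousLinearMap.mul_apply, ← hc.mul_pow, hR, U.mul_inv, one_pow]; rfl
    have e2 : ∀ n (x : X), (R ^ n) (((U : X →L[ℂ] X) ^ n) x) = x := by
      intro n x
      rw [← ContinuousLinearMap.mul_apply, ← hc.symm.mul_pow, hR, U.inv_mul, one_pow]; rfl
    constructor
    · ext y
      simp only [Set.mem_univ, iff_true]
      refine ⟨id, strictMono_id, fun n => (R ^ n) y, ?_, ?_⟩
      · refine squeeze_zero_norm (fun n => (R ^ n).le_opNorm y) ?_
        simpa using lim.mul_const ‖y‖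
      · simp only [id, e1]
        exact tendsto_const_nhds
    · intro x hx hJ
      have : (0 : X) ∈ JSet (U : X →L[ℂ] X) x := hJ ▸ Set.mem_univ _
      obtain ⟨k, hk, u, hu, hTu⟩ := this
      apply hx
      refine tendsto_nhds_unique hu ?_
      refine squeeze_zero_norm (a := fun n => ‖R ^ k n‖ * ‖((U : X →L[ℂ] X) ^ k n) (u n)‖)
        (fun n => ?_) ?_
      · conv_lhs => rw [← e2 (k n) (u n)]
        exact (R ^ k n).le_opNorm _
      · simpa using (lim.comp hk.tendsto_atTop).mul hTu.norm
end
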